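/- Let G be a finite simple graph such that the intersection of all maximum stable sets of G is empty and the intersection of all minimum vertex covers of G is empty. Then 2·α(G) ≤ |V(G)|. -/

import Mathlib

/-- A set of vertices is stable (independent) if no two of its vertices are adjacent. -/
def IsStable {V : Type*} (G : SimpleGraph V) (S : Set V) : Prop :=
  ∀ ⦃u⦄, u ∈ S → ∀ ⦃v⦄, v ∈ S → ¬ G.Adj u v

/-- A set of vertices is a vertex cover if it meets every edge. -/
def IsCover {V : Type*} (G : SimpleGraph V) (C : Set V) : Prop :=
  ∀ ⦃u v⦄, G.Adj u v → u ∈ C ∨ v ∈ C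

/-- The stability number α(G): the maximum size of a stable set. -/
noncomputable def alphaNum {V : Type*} (G : SimpleGraph V) : ℕ :=
  sSup {n | ∃ S : Set V, IsStable G S ∧ S.ncard = n}

/-- The vertex covering number τ(G): the minimum size of a vertex cover. -/
noncomputable def tauNum {V : Type*} (G : SimpleGraph V) : ℕ :=
  sInf {n | ∃ C : Set V, IsCover G C ∧ C.ncard = n}

/-- An inclusionwise maximal stable set. -/
def IsMaximalStable {V : Type*} (G : SimpleGraph V) (S : Set V) : Prop :=
  IsStable G S ∧ ∀ T : Set V, IsStable G T → S ⊆ T → S = T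

/-- The σ_v-cover number: the maximum m such that every vertex belongs to a
maximal stable set with at least m vertices. -/
noncomputable def sigmaV {V : Type*} (G : SimpleGraph V) : ℕ :=
  sSup {m | ∀ v : V, ∃ S : Set V, v ∈ S ∧ IsMaximalStable G S ∧ m ≤ S.ncard}

/-- α_core(G): the intersection of all maximum stable sets of G. -/
def alphaCore {V : Type*} (G : SimpleGraph V) : Set V :=
  {v | ∀ S : Set V, IsStable G S → S.ncard = alphaNum G → v ∈ S}

/-- τ_core(G): the intersection of all minimum vertex covers of G. -/
def tauCore {V : Type*} (G : SimpleGraph V) : Set V :=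
  {v | ∀ C : Set V, IsCover G C → C.ncard = tauNum G → v ∈ C}

theorem IsStable.ncard_le_alphaNum {V : Type*} [Finite V] {G : SimpleGraph V} {S : Set V}
    (hS : IsStable G S) : S.ncard ≤ alphaNum G := by
  refine le_csSup ⟨Nat.card V, ?_⟩ ⟨S, hS, rfl⟩
  rintro n ⟨T, -, rfl⟩
  exact Set.ncard_le_card T

theorem exists_isStable_ncard_eq_alphaNum {V : Type*} [Finite V] (G : SimpleGraph V) :
    ∃ S : Set V, IsStable G S ∧ S.ncard = alphaNum G := by
  refine Nat.sSup_mem (s := {n | ∃ S : Set V, IsStable G S ∧ S.ncard = n})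
    ⟨0, ∅, fun _ h => h.elim, Set.ncard_empty V⟩ ⟨Nat.card V, ?_⟩
  rintro n ⟨T, -, rfl⟩
  exact Set.ncard_le_card T

/-- The part of a stable set covered by a family of stable sets stays stable when the
intersection of the family is added to it. -/
theorem IsStable.inter_sUnion_union_sInter {V : Type*} {G : SimpleGraph V} {S : Set V}
    {F : Set (Set V)} (hS : IsStable G S) (hF : ∀ T ∈ F, IsStable G T) (hne : F.Nonempty) :
    IsStable G (S ∩ ⋃₀ F ∪ ⋂₀ F) := by
  rintro u (⟨huS, T, hT, huT⟩ | hu) v (⟨hvS, T', hT', hvT'⟩ | hv)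
  · exact hS huS hvS
  · exact hF T hT huT (hv T hT)
  · exact hF T' hT' (hu T' hT') hvT'
  · obtain ⟨T, hT⟩ := hne
    exact hF T hT (hu T hT) (hv T hT)

/-- For a nonempty family of maximum stable sets, the sizes of the intersection and of the union
add up to at least twice the stability number. -/
theorem two_mul_alphaNum_le_ncard_sInter_add_ncard_sUnion {V : Type*} [Finite V]
    (G : SimpleGraph V) {F : Set (Set V)} (hne : F.Nonempty)
    (hF : ∀ S ∈ F, IsStable G S ∧ S.ncard = alphaNum G) :
    2 * alphaNum G ≤ (⋂₀ F).ncard + (⋃₀ F).ncard := by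
  induction F, F.toFinite using Set.Finite.induction_on with
  | empty => exact absurd hne Set.not_nonempty_empty
  | @insert S F _ _ ih =>
    obtain ⟨hS, hcard⟩ := hF S (Set.mem_insert S F)
    have hF' : ∀ T ∈ F, IsStable G T ∧ T.ncard = alphaNum G :=
      fun T hT => hF T (Set.mem_insert_of_mem S hT)
    rcases F.eq_empty_or_nonempty with rfl | hne'
    · simp [hcard, two_mul]
    · have hle := (hS.inter_sUnion_union_sInter (fun T hT => (hF' T hT).1) hne').ncard_le_alphaNum
      have hsub : S ∩ ⋃₀ F ∩ ⋂₀ F = S ∩ ⋂₀ F := by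
        obtain ⟨T, hT⟩ := hne'
        ext x
        exact ⟨fun h => ⟨h.1.1, h.2⟩, fun h => ⟨⟨h.1, T, hT, h.2 T hT⟩, h.2⟩⟩
      have e₁ := Set.ncard_union_add_ncard_inter (S ∩ ⋃₀ F) (⋂₀ F)
      have e₂ := Set.ncard_union_add_ncard_inter S (⋃₀ F)
      rw [hsub] at e₁
      rw [Set.sInter_insert, Set.sUnion_insert]
      have := ih hne' hF'
      omega

/-- If the intersection of all maximum stable sets of G is empty and the
intersection of all minimum vertex covers of G is empty, then 2·α(G) ≤ |V(G)|. -/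
theorem stmt_8 {V : Type*} [Fintype V] (G : SimpleGraph V)
    (h1 : alphaCore G = ∅) (h2 : tauCore G = ∅) :
    2 * alphaNum G ≤ Fintype.card V := by
  have hle := two_mul_alphaNum_le_ncard_sInter_add_ncard_sUnion G
    (F := {S | IsStable G S ∧ S.ncard = alphaNum G})
    (exists_isStable_ncard_eq_alphaNum G) (fun _ hS => hS)
  have hcore : ⋂₀ {S | IsStable G S ∧ S.ncard = alphaNum G} = ∅ := by
    rw [← h1]
    ext v
    simp [alphaCore]
  rw [hcore, Set.ncard_empty, zero_add] at hle
  rw [← Nat.card_eq_fintype_card]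
  exact hle.trans (Set.ncard_le_card _)
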